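/- (Theorem S3.3, item 2) Suppose the random vectors P_1 and P_2 are independent, with arbitrary dependence among the coordinates within each of P_1 and P_2, and the selection rules S_{12} and S_{21} are valid selection rules. Consider Procedure 4.1 with parameters (w_1, q_1, q) in which each application of Procedure 3.2 (with respective parameters (w_1 q_1, w_1 q) and ((1−w_1)q_1, (1−w_1)q)) is modified as follows: in its primary-study thresholds (of the form r·a/m and R_2·a/m, where a is its first parameter), a is replaced by a/(∑_{i=1}^m 1/i); and in its follow-up thresholds (of the form r·b/R_1 and R_2·b/R_1, where b is the difference of its two parameters), b is replaced by b/(∑_{i=1}^{R_1} 1/i). Then the rejection set 𝓡_{12} ∪ 𝓡_{21} of this modified Procedure 4.1 satisfies FDR ≤ q for the family of no-replicability nulls H_{NR,1},…,H_{NR,m}. -/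

import Mathlib

open MeasureTheory ProbabilityTheory Finset

namespace Replicability

/-- A selection rule `S` is measurable: the preimage of each possible selected set is a
measurable subset of `[0,1]^m` (here all of `ℝ^m`). -/
def MeasRule (m : ℕ) (S : (Fin m → ℝ) → Finset (Fin m)) : Prop :=
  ∀ A : Finset (Fin m), MeasurableSet {p : Fin m → ℝ | S p = A}

/-- A valid selection rule: for any `p`, any `j ∈ S p`, and any `p'` agreeing with `p` in all
coordinates except possibly the `j`-th such that `j` is still selected under `p'`,
the selected set is unchanged. -/
def ValidRule (m : ℕ) (S : (Fin m → ℝ) → Finset (Fin m)) : Prop :=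
  ∀ p p' : Fin m → ℝ, ∀ j ∈ S p, (∀ i, i ≠ j → p' i = p i) → j ∈ S p' → S p' = S p

/-- Null p-values are superuniform: if `h j = false` (hypothesis `j` is a true null in this
study) then `Pr(P_j ≤ x) ≤ x` for all `x ∈ [0,1]`. -/
def Superuniform {Ω : Type*} [MeasurableSpace Ω] (μ : Measure Ω) {m : ℕ}
    (P : Ω → Fin m → ℝ) (h : Fin m → Bool) : Prop :=
  ∀ j : Fin m, h j = false → ∀ x : ℝ, 0 ≤ x → x ≤ 1 →
    μ {ω | P ω j ≤ x} ≤ ENNReal.ofReal x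

/-- p-values take values in `[0,1]`. -/
def InUnit {Ω : Type*} {m : ℕ} (P : Ω → Fin m → ℝ) : Prop :=
  ∀ ω j, P ω j ∈ Set.Icc (0 : ℝ) 1

/-- The (generalized) rejection set of Procedure 3.2: with selected set `𝓡₁ = S p₁` of size
`R₁`, primary thresholds `r * a / m` and follow-up thresholds `r * b R₁ / R₁`, let
`R₂ = max { r ≤ m : #{j ∈ 𝓡₁ : p₁ⱼ ≤ r a/m ∧ p₂ⱼ ≤ r (b R₁)/R₁} = r }`, and reject
`{j ∈ 𝓡₁ : p₁ⱼ ≤ R₂ a/m ∧ p₂ⱼ ≤ R₂ (b R₁)/R₁}`.  The basic Procedure 3.2 with parameters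
`(q₁, q)` is obtained with `a = q₁` and `b = fun _ => q - q₁`. -/
noncomputable def rejSet (m : ℕ) (S : (Fin m → ℝ) → Finset (Fin m))
    (a : ℝ) (b : ℕ → ℝ) (p1 p2 : Fin m → ℝ) : Finset (Fin m) :=
  let R1 := (S p1).card
  let R2 := sSup {r : ℕ | r ≤ m ∧
    ((S p1).filter
      (fun j => p1 j ≤ r * a / m ∧ p2 j ≤ r * b R1 / R1)).card = r}
  (S p1).filter (fun j => p1 j ≤ R2 * a / m ∧ p2 j ≤ R2 * b R1 / R1)

/-- False discovery proportion of rejection set `R` with respect to the set `I` of true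
nulls: `|R ∩ I| / max(|R|, 1)`. -/
noncomputable def FDP {m : ℕ} (I R : Finset (Fin m)) : ℝ :=
  ((R ∩ I).card : ℝ) / ((max R.card 1 : ℕ) : ℝ)

/-- The set `I_{ab} = {j : (h₁ⱼ, h₂ⱼ) = (a, b)}` (with `true` for 1, `false` for 0). -/
def Iset {m : ℕ} (h1 h2 : Fin m → Bool) (a b : Bool) : Finset (Fin m) :=
  Finset.univ.filter fun j => h1 j = a ∧ h2 j = b

/-- The indices of true no-replicability nulls: `I₀₀ ∪ I₀₁ ∪ I₁₀`. -/
def nullNR {m : ℕ} (h1 h2 : Fin m → Bool) : Finset (Fin m) :=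
  Finset.univ.filter fun j => h1 j = false ∨ h2 j = false

/-- Harmonic sum `∑_{i=1}^n 1/i`. -/
noncomputable def Hsum (n : ℕ) : ℝ := ∑ i ∈ Finset.range n, (1 : ℝ) / (i + 1)

/-- PRDS property of a random vector `Q` on a set `T` of coordinates: for every measurable
increasing set `D` and every `i ∈ T`, some monotone measurable `g` is a version of
`p ↦ Pr(Q ∈ D | Q_i = p)`. -/
def PRDS {Ω : Type*} [MeasurableSpace Ω] (μ : Measure Ω) {m : ℕ}
    (Q : Ω → Fin m → ℝ) (T : Set (Fin m)) : Prop :=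
  ∀ D : Set (Fin m → ℝ), MeasurableSet D →
    (∀ x ∈ D, ∀ y : Fin m → ℝ, x ≤ y → y ∈ D) →
    ∀ i ∈ T, ∃ g : ℝ → ℝ, Monotone g ∧ Measurable g ∧
      ∀ B : Set ℝ, MeasurableSet B →
        (μ ({ω | Q ω ∈ D} ∩ {ω | Q ω i ∈ B})).toReal =
          ∫ ω in {ω | Q ω i ∈ B}, g (Q ω i) ∂μ

end Replicability

namespace Replicability

lemma Hsum_nonneg (n : ℕ) : 0 ≤ Hsum n :=
  Finset.sum_nonneg fun i _ => by positivity

lemma Hsum_pos {n : ℕ} (hn : 0 < n) : 0 < Hsum n :=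
  Finset.sum_pos (fun i _ => by positivity) ⟨0, Finset.mem_range.2 hn⟩

lemma FDP_nonneg {m : ℕ} (I R : Finset (Fin m)) : 0 ≤ FDP I R := by
  unfold FDP
  positivity

lemma FDP_empty {m : ℕ} (I : Finset (Fin m)) : FDP I ∅ = 0 := by
  simp [FDP]

lemma FDP_union_le {m : ℕ} (I R R' : Finset (Fin m)) :
    FDP I (R ∪ R') ≤ FDP I R + FDP I R' := by
  have hmono : ∀ T T' : Finset (Fin m), T ⊆ T' →
      ((T ∩ I).card : ℝ) / ((max T'.card 1 : ℕ) : ℝ) ≤ FDP I T := by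
    intro T T' h
    unfold FDP
    have h0 : 0 < max T.card 1 := by positivity
    have h1 : max T.card 1 ≤ max T'.card 1 := max_le_max_right _ (Finset.card_le_card h)
    gcongr
  have hcard : (((R ∪ R') ∩ I).card : ℝ) ≤ (R ∩ I).card + (R' ∩ I).card := by
    rw [Finset.union_inter_distrib_right]
    exact_mod_cast Finset.card_union_le _ _
  calc FDP I (R ∪ R')
      ≤ ((R ∩ I).card + (R' ∩ I).card : ℝ) / ((max (R ∪ R').card 1 : ℕ) : ℝ) := by
        unfold FDP
        gcongr
    _ ≤ FDP I R + FDP I R' := by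
        rw [add_div]
        exact add_le_add (hmono _ _ Finset.subset_union_left) (hmono _ _ Finset.subset_union_right)

/-- The rejections of Procedure 3.2 satisfy the thresholds given by their own number. -/
lemma le_of_mem_rejSet {m : ℕ} {S : (Fin m → ℝ) → Finset (Fin m)} {a : ℝ} {b : ℕ → ℝ}
    {p1 p2 : Fin m → ℝ} (ha : 0 ≤ a) (hb : ∀ n, 0 ≤ b n) {j : Fin m}
    (hj : j ∈ rejSet m S a b p1 p2) :
    p1 j ≤ a / m * (rejSet m S a b p1 p2).card ∧
      p2 j ≤ b (S p1).card / (S p1).card * (rejSet m S a b p1 p2).card := by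
  set T : Set ℕ := {r : ℕ | r ≤ m ∧ ((S p1).filter (fun j => p1 j ≤ r * a / m ∧
    p2 j ≤ r * b (S p1).card / (S p1).card)).card = r} with hT
  have hR : rejSet m S a b p1 p2 = (S p1).filter (fun j => p1 j ≤ (sSup T : ℕ) * a / m ∧
    p2 j ≤ (sSup T : ℕ) * b (S p1).card / (S p1).card) := rfl
  have hle : sSup T ≤ (rejSet m S a b p1 p2).card := by
    rcases T.eq_empty_or_nonempty with h | h
    · simp [h]
    · exact (Nat.sSup_mem h ⟨m, fun r hr => hr.1⟩).2.ge
  have hle' : ((sSup T : ℕ) : ℝ) ≤ (rejSet m S a b p1 p2).card := by exact_mod_cast hle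
  have hbn := hb (S p1).card
  have hj' := hj
  rw [hR, Finset.mem_filter] at hj'
  refine ⟨hj'.2.1.trans ?_, hj'.2.2.trans ?_⟩
  · rw [mul_div_assoc, mul_comm]
    gcongr
  · rw [mul_div_assoc, mul_comm]
    gcongr

lemma rejSet_subset {m : ℕ} (S : (Fin m → ℝ) → Finset (Fin m)) (a : ℝ) (b : ℕ → ℝ)
    (p1 p2 : Fin m → ℝ) : rejSet m S a b p1 p2 ⊆ S p1 :=
  Finset.filter_subset _ _

/-- The Benjamini–Yekutieli majorant: a function of a single p-value `p` that dominates `1 / r`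
for every `1 ≤ r ≤ n` with `p ≤ c * r`. -/
noncomputable def byMajorant (n : ℕ) (c p : ℝ) : ℝ :=
  ∑ k ∈ Finset.range n,
      (Set.Iic (c * (k + 1))).indicator (fun _ => 1 / (((k : ℝ) + 1) * (k + 2))) p
    + (Set.Iic (c * n)).indicator (fun _ => 1 / ((n : ℝ) + 1)) p

lemma byMajorant_nonneg (n : ℕ) (c p : ℝ) : 0 ≤ byMajorant n c p := by
  unfold byMajorant
  refine add_nonneg (Finset.sum_nonneg fun k _ => ?_) ?_ <;>
    exact Set.indicator_nonneg (fun _ _ => by positivity) _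

lemma sum_Ico_telescope {r n : ℕ} (hrn : r ≤ n) :
    ∑ k ∈ Finset.Ico r n, 1 / (((k : ℝ) + 1) * (k + 2)) + 1 / ((n : ℝ) + 1) = 1 / ((r : ℝ) + 1) := by
  induction n, hrn using Nat.le_induction with
  | base => simp
  | succ n hn ih =>
    rw [Finset.sum_Ico_succ_top hn, ← ih]
    push_cast
    field_simp
    ring

lemma inv_le_byMajorant {n r : ℕ} {c p : ℝ} (hc : 0 ≤ c) (hr : 1 ≤ r) (hrn : r ≤ n)
    (hp : p ≤ c * r) : 1 / (r : ℝ) ≤ byMajorant n c p := by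
  obtain ⟨s, rfl⟩ : ∃ s, r = s + 1 := ⟨r - 1, by omega⟩
  push_cast at hp ⊢
  rw [← sum_Ico_telescope (show s ≤ n by omega)]
  unfold byMajorant
  refine add_le_add ?_ ?_
  · calc ∑ k ∈ Finset.Ico s n, 1 / (((k : ℝ) + 1) * (k + 2))
        = ∑ k ∈ Finset.Ico s n, (Set.Iic (c * (k + 1))).indicator
            (fun _ => 1 / (((k : ℝ) + 1) * (k + 2))) p := by
          refine Finset.sum_congr rfl fun k hk => ?_
          have hsk : (s : ℝ) ≤ k := by exact_mod_cast (Finset.mem_Ico.1 hk).1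
          rw [Set.indicator_of_mem]
          exact hp.trans (by gcongr)
      _ ≤ _ := by
          refine Finset.sum_le_sum_of_subset_of_nonneg (fun k hk => ?_) fun k _ _ => ?_
          · exact Finset.mem_range.2 (Finset.mem_Ico.1 hk).2
          · exact Set.indicator_nonneg (fun _ _ => by positivity) _
  · have hsn : (s : ℝ) + 1 ≤ n := by exact_mod_cast hrn
    rw [Set.indicator_of_mem]
    exact hp.trans (by gcongr)

lemma measurable_byMajorant (n : ℕ) (c : ℝ) : Measurable (byMajorant n c) := by
  unfold byMajorant
  refine Measurable.add (Finset.measurable_fun_sum _ fun k _ => ?_) ?_ <;>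
    exact measurable_const.indicator measurableSet_Iic

section

variable {Ω : Type*} [MeasurableSpace Ω] {μ : Measure Ω} [IsProbabilityMeasure μ]

lemma integrable_indicator_Iic_comp {X : Ω → ℝ} (hX : Measurable X) (x t : ℝ) :
    Integrable (fun ω => (Set.Iic x).indicator (fun _ => t) (X ω)) μ :=
  (integrable_const t).indicator (s := X ⁻¹' Set.Iic x) (hX measurableSet_Iic)

lemma integrable_byMajorant {X : Ω → ℝ} (hX : Measurable X) (n : ℕ) (c : ℝ) :
    Integrable (fun ω => byMajorant n c (X ω)) μ :=
  (integrable_finsetSum _ fun _ _ => integrable_indicator_Iic_comp hX _ _).add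
    (integrable_indicator_Iic_comp hX _ _)

lemma integral_indicator_Iic_comp_le {X : Ω → ℝ} (hX : Measurable X)
    (hsup : ∀ x : ℝ, 0 ≤ x → x ≤ 1 → μ {ω | X ω ≤ x} ≤ ENNReal.ofReal x)
    {x t : ℝ} (hx : 0 ≤ x) (ht : 0 ≤ t) :
    ∫ ω, (Set.Iic x).indicator (fun _ => t) (X ω) ∂μ ≤ x * t := by
  have h : ∫ ω, (Set.Iic x).indicator (fun _ => t) (X ω) ∂μ = μ.real {ω | X ω ≤ x} * t :=
    integral_indicator_const t (s := X ⁻¹' Set.Iic x) (hX measurableSet_Iic)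
  rw [h]
  gcongr
  rcases le_or_gt x 1 with h1 | h1
  · exact ENNReal.toReal_le_of_le_ofReal hx (hsup x hx h1)
  · exact measureReal_le_one.trans h1.le

lemma integral_byMajorant_le {X : Ω → ℝ} (hX : Measurable X)
    (hsup : ∀ x : ℝ, 0 ≤ x → x ≤ 1 → μ {ω | X ω ≤ x} ≤ ENNReal.ofReal x)
    (n : ℕ) {c : ℝ} (hc : 0 ≤ c) :
    ∫ ω, byMajorant n c (X ω) ∂μ ≤ c * Hsum n := by
  unfold byMajorant
  rw [integral_add (integrable_finsetSum _ fun _ _ => integrable_indicator_Iic_comp hX _ _)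
    (integrable_indicator_Iic_comp hX _ _),
    integral_finsetSum _ fun _ _ => integrable_indicator_Iic_comp hX _ _]
  refine (add_le_add (Finset.sum_le_sum fun k _ =>
    integral_indicator_Iic_comp_le hX hsup (by positivity) (by positivity))
    (integral_indicator_Iic_comp_le hX hsup (by positivity) (by positivity))).trans_eq ?_
  induction n with
  | zero => simp [Hsum]
  | succ n ih =>
    have hH : Hsum (n + 1) = Hsum n + 1 / ((n : ℝ) + 1) := by simp [Hsum, Finset.sum_range_succ]
    rw [Finset.sum_range_succ, hH, mul_add c (Hsum n), ← ih]
    push_cast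
    field_simp
    ring

end

lemma FDP_le_sum_add_sum {m : ℕ} (h1 h2 : Fin m → Bool) (R : Finset (Fin m)) :
    FDP (nullNR h1 h2) R ≤
      ∑ j ∈ R with h1 j = false, 1 / (R.card : ℝ) + ∑ j ∈ R with h2 j = false, 1 / (R.card : ℝ) := by
  rcases R.eq_empty_or_nonempty with rfl | hR
  · simp [FDP]
  have hcard : R ∩ nullNR h1 h2 =
      R.filter (fun j => h1 j = false) ∪ R.filter (fun j => h2 j = false) := by
    ext j
    simp only [nullNR, Finset.mem_inter, Finset.mem_filter, Finset.mem_univ, true_and,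
      Finset.mem_union]
    tauto
  have hle : ((R ∩ nullNR h1 h2).card : ℝ) ≤
      (R.filter (fun j => h1 j = false)).card + (R.filter (fun j => h2 j = false)).card := by
    rw [hcard]
    exact_mod_cast Finset.card_union_le _ _
  rw [FDP, max_eq_left hR.card_pos, Finset.sum_const, Finset.sum_const, nsmul_eq_mul,
    nsmul_eq_mul, ← add_mul, mul_one_div]
  gcongr

/-- An upper bound for the false discovery proportion of Procedure 3.2: in the first sum each term
depends on one p-value of the primary study only, in the second sum on the selected set and one
p-value of the follow-up study. -/
noncomputable def fdpMajorant {m : ℕ} (h1 h2 : Fin m → Bool) (S : (Fin m → ℝ) → Finset (Fin m))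
    (a : ℝ) (b : ℕ → ℝ) (p1 p2 : Fin m → ℝ) : ℝ :=
  ∑ j with h1 j = false, byMajorant m (a / m) (p1 j) +
    ∑ A : Finset (Fin m), ∑ j ∈ A with h2 j = false,
      {p | S p = A}.indicator (fun _ => (1 : ℝ)) p1 * byMajorant A.card (b A.card / A.card) (p2 j)

lemma FDP_rejSet_le {m : ℕ} (h1 h2 : Fin m → Bool) (S : (Fin m → ℝ) → Finset (Fin m))
    {a : ℝ} {b : ℕ → ℝ} (ha : 0 ≤ a) (hb : ∀ n, 0 ≤ b n) (p1 p2 : Fin m → ℝ) :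
    FDP (nullNR h1 h2) (rejSet m S a b p1 p2) ≤ fdpMajorant h1 h2 S a b p1 p2 := by
  have hsub := rejSet_subset S a b p1 p2
  have hpos : ∀ j ∈ rejSet m S a b p1 p2, 1 ≤ (rejSet m S a b p1 p2).card :=
    fun j hj => Finset.card_pos.2 ⟨j, hj⟩
  have hbn := hb (S p1).card
  refine (FDP_le_sum_add_sum h1 h2 _).trans (add_le_add ?_ ?_)
  · refine (Finset.sum_le_sum fun j hj => ?_).trans
      (Finset.sum_le_sum_of_subset_of_nonneg
        (Finset.filter_subset_filter _ (Finset.subset_univ _)) fun j _ _ => byMajorant_nonneg _ _ _)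
    have hj := (Finset.mem_filter.1 hj).1
    exact inv_le_byMajorant (by positivity) (hpos j hj)
      ((Finset.card_le_univ _).trans_eq (Fintype.card_fin m)) (le_of_mem_rejSet ha hb hj).1
  · rw [Finset.sum_eq_single_of_mem (S p1) (Finset.mem_univ _)]
    · refine (Finset.sum_le_sum fun j hj => ?_).trans
        (Finset.sum_le_sum_of_subset_of_nonneg
          (Finset.filter_subset_filter _ hsub) fun j _ _ => ?_)
      · have hj := (Finset.mem_filter.1 hj).1
        rw [Set.indicator_of_mem (by rfl), one_mul]
        exact inv_le_byMajorant (by positivity) (hpos j hj)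
          (Finset.card_le_card hsub) (le_of_mem_rejSet ha hb hj).2
      · exact mul_nonneg (Set.indicator_nonneg (fun _ _ => zero_le_one) _)
          (byMajorant_nonneg _ _ _)
    · intro A _ hA
      refine Finset.sum_eq_zero fun j _ => ?_
      have hp : p1 ∉ {p | S p = A} := fun h => hA (Eq.symm h)
      rw [Set.indicator_of_notMem hp, zero_mul]

section

variable {Ω : Type*} [MeasurableSpace Ω] {μ : Measure Ω} {m : ℕ}
  {P1 P2 : Ω → Fin m → ℝ} {S : (Fin m → ℝ) → Finset (Fin m)}

lemma indepFun_indicator_rule (hIndep : IndepFun P1 P2 μ) (hS : MeasRule m S)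
    (A : Finset (Fin m)) (n : ℕ) (c : ℝ) (j : Fin m) :
    IndepFun (fun ω => {p | S p = A}.indicator (fun _ => (1 : ℝ)) (P1 ω))
      (fun ω => byMajorant n c (P2 ω j)) μ := by
  have hφ : Measurable ({p | S p = A}.indicator (fun _ => (1 : ℝ))) :=
    measurable_const.indicator (hS A)
  have hψ : Measurable (fun p : Fin m → ℝ => byMajorant n c (p j)) :=
    (measurable_byMajorant n c).comp (measurable_pi_apply j)
  exact hIndep.comp hφ hψ

variable [IsProbabilityMeasure μ]

lemma integrable_indicator_rule (hP1 : Measurable P1) (hS : MeasRule m S) (A : Finset (Fin m)) :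
    Integrable (fun ω => {p | S p = A}.indicator (fun _ => (1 : ℝ)) (P1 ω)) μ :=
  (integrable_const 1).indicator (s := P1 ⁻¹' {p | S p = A}) (hP1 (hS A))

lemma integrable_indicator_mul_byMajorant (hP1 : Measurable P1) (hP2 : Measurable P2)
    (hIndep : IndepFun P1 P2 μ) (hS : MeasRule m S)
    (A : Finset (Fin m)) (n : ℕ) (c : ℝ) (j : Fin m) :
    Integrable (fun ω => {p | S p = A}.indicator (fun _ => (1 : ℝ)) (P1 ω) *
      byMajorant n c (P2 ω j)) μ :=
  (indepFun_indicator_rule hIndep hS A n c j).integrable_mul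
    (integrable_indicator_rule hP1 hS A) (integrable_byMajorant (hP2.eval) n c)

lemma integrable_fdpMajorant (h1 h2 : Fin m → Bool) (hP1 : Measurable P1) (hP2 : Measurable P2)
    (hIndep : IndepFun P1 P2 μ) (hS : MeasRule m S) (a : ℝ) (b : ℕ → ℝ) :
    Integrable (fun ω => fdpMajorant h1 h2 S a b (P1 ω) (P2 ω)) μ :=
  (integrable_finsetSum _ fun _ _ => integrable_byMajorant hP1.eval _ _).add
    (integrable_finsetSum _ fun _ _ => integrable_finsetSum _ fun _ _ =>
      integrable_indicator_mul_byMajorant hP1 hP2 hIndep hS _ _ _ _)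

lemma sum_integral_indicator_rule (hP1 : Measurable P1) (hS : MeasRule m S) :
    ∑ A : Finset (Fin m), ∫ ω, {p | S p = A}.indicator (fun _ => (1 : ℝ)) (P1 ω) ∂μ = 1 := by
  rw [← integral_finsetSum _ fun A _ => integrable_indicator_rule hP1 hS A]
  have h : ∀ ω, ∑ A : Finset (Fin m), {p | S p = A}.indicator (fun _ => (1 : ℝ)) (P1 ω) = 1 := by
    intro ω
    simp [Set.indicator_apply]
  simp [h]

lemma integral_fdpMajorant_le (h1 h2 : Fin m → Bool) (hP1 : Measurable P1) (hP2 : Measurable P2)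
    (hsup1 : Superuniform μ P1 h1) (hsup2 : Superuniform μ P2 h2)
    (hIndep : IndepFun P1 P2 μ) (hS : MeasRule m S) {α β : ℝ} (hα : 0 ≤ α) (hβ : 0 ≤ β) :
    ∫ ω, fdpMajorant h1 h2 S (α / Hsum m) (fun n => β / Hsum n) (P1 ω) (P2 ω) ∂μ ≤ α + β := by
  -- the sum of at most `n` terms, each bounded by the Benjamini–Yekutieli bound
  have key : ∀ (γ : ℝ), 0 ≤ γ → ∀ s : Finset (Fin m), ∀ n : ℕ, s.card ≤ n → ∀ f : Fin m → ℝ,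
      (∀ j ∈ s, f j ≤ γ / Hsum n / n * Hsum n) → ∑ j ∈ s, f j ≤ γ := by
    intro γ hγ s n hsn f hf
    refine (Finset.sum_le_card_nsmul s f _ hf).trans ?_
    rw [nsmul_eq_mul]
    have hH := Hsum_nonneg n
    have hsn' : (s.card : ℝ) ≤ n := by exact_mod_cast hsn
    calc (s.card : ℝ) * (γ / Hsum n / n * Hsum n) ≤ n * (γ / Hsum n / n * Hsum n) := by gcongr
      _ ≤ γ := by
        rcases Nat.eq_zero_or_pos n with rfl | hn
        · simpa using hγ
        · have := Hsum_pos hn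
          have : (0 : ℝ) < n := by exact_mod_cast hn
          exact le_of_eq (by field_simp)
  have hHm := Hsum_nonneg m
  unfold fdpMajorant
  rw [integral_add (integrable_finsetSum _ fun _ _ => integrable_byMajorant hP1.eval _ _)
    (integrable_finsetSum _ fun _ _ => integrable_finsetSum _ fun _ _ =>
      integrable_indicator_mul_byMajorant hP1 hP2 hIndep hS _ _ _ _),
    integral_finsetSum _ fun _ _ => integrable_byMajorant hP1.eval _ _,
    integral_finsetSum _ fun _ _ => integrable_finsetSum _ fun _ _ =>
      integrable_indicator_mul_byMajorant hP1 hP2 hIndep hS _ _ _ _]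
  refine add_le_add ?_ ?_
  · refine key α hα _ m ((Finset.card_le_univ _).trans_eq (Fintype.card_fin m)) _ fun j hj => ?_
    exact integral_byMajorant_le hP1.eval (hsup1 j (Finset.mem_filter.1 hj).2) m (by positivity)
  · calc _ ≤ ∑ A : Finset (Fin m),
          (∫ ω, {p | S p = A}.indicator (fun _ => (1 : ℝ)) (P1 ω) ∂μ) * β := by
          refine Finset.sum_le_sum fun A _ => ?_
          have hH := Hsum_nonneg A.card
          rw [integral_finsetSum _ fun _ _ =>
            integrable_indicator_mul_byMajorant hP1 hP2 hIndep hS _ _ _ _]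
          simp_rw [(indepFun_indicator_rule hIndep hS A _ _ _).integral_fun_mul_eq_mul_integral
            (integrable_indicator_rule hP1 hS A).aestronglyMeasurable
            (integrable_byMajorant hP2.eval _ _).aestronglyMeasurable]
          rw [← Finset.mul_sum]
          refine mul_le_mul_of_nonneg_left ?_
            (integral_nonneg fun ω => Set.indicator_nonneg (fun _ _ => zero_le_one) _)
          refine key β hβ _ A.card (Finset.card_filter_le _ _) _ fun j hj => ?_
          exact integral_byMajorant_le hP2.eval (hsup2 j (Finset.mem_filter.1 hj).2) _
            (by positivity)
      _ = β := by rw [← Finset.sum_mul, sum_integral_indicator_rule hP1 hS, one_mul]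

end

/-- Theorem S3.3, item 2: with the two studies independent (arbitrary
dependence within each study) and valid selection rules, Procedure 4.1 with parameters
`(w₁, q₁, q)` in which each application of Procedure 3.2 has its primary parameter `a` replaced
by `a/(∑_{i=1}^m 1/i)` and its follow-up parameter `b` replaced by `b/(∑_{i=1}^{R₁} 1/i)`
controls the FDR at level `q` for the no-replicability nulls. -/
theorem theorem_S33_item2 {Ω : Type*} [MeasurableSpace Ω]
    (μ : Measure Ω) [IsProbabilityMeasure μ]
    (m : ℕ) (hm : 1 ≤ m)
    (P1 P2 : Ω → Fin m → ℝ) (hP1 : Measurable P1) (hP2 : Measurable P2)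
    (hP1u : InUnit P1) (hP2u : InUnit P2)
    (h1 h2 : Fin m → Bool)
    (hsup1 : Superuniform μ P1 h1) (hsup2 : Superuniform μ P2 h2)
    (hIndep : IndepFun P1 P2 μ)
    (S12 S21 : (Fin m → ℝ) → Finset (Fin m))
    (hS12 : MeasRule m S12) (hS21 : MeasRule m S21)
    (hval12 : ValidRule m S12) (hval21 : ValidRule m S21)
    (w1 : ℝ) (hw0 : 0 ≤ w1) (hw1 : w1 ≤ 1)
    (q1 q : ℝ) (hq1 : 0 < q1) (hq1q : q1 < q) (hq : q < 1) :
    ∫ ω, FDP (nullNR h1 h2)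
        ((if w1 = 0 then ∅ else
            rejSet m S12 (w1 * q1 / Hsum m)
              (fun R1 => (w1 * q - w1 * q1) / Hsum R1) (P1 ω) (P2 ω))
          ∪ (if w1 = 1 then ∅ else
            rejSet m S21 ((1 - w1) * q1 / Hsum m)
              (fun R1 => ((1 - w1) * q - (1 - w1) * q1) / Hsum R1)
              (P2 ω) (P1 ω))) ∂μ ≤ q := by
  set a12 := w1 * q1 / Hsum m
  set a21 := (1 - w1) * q1 / Hsum m
  set b12 : ℕ → ℝ := fun R1 => (w1 * q - w1 * q1) / Hsum R1
  set b21 : ℕ → ℝ := fun R1 => ((1 - w1) * q - (1 - w1) * q1) / Hsum R1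
  have hw1' : 0 ≤ 1 - w1 := sub_nonneg.2 hw1
  have hβ12 : 0 ≤ w1 * q - w1 * q1 := by
    rw [← mul_sub]
    exact mul_nonneg hw0 (sub_nonneg.2 hq1q.le)
  have hβ21 : 0 ≤ (1 - w1) * q - (1 - w1) * q1 := by
    rw [← mul_sub]
    exact mul_nonneg hw1' (sub_nonneg.2 hq1q.le)
  have ha12 : 0 ≤ a12 := div_nonneg (by positivity) (Hsum_nonneg m)
  have ha21 : 0 ≤ a21 := div_nonneg (by positivity) (Hsum_nonneg m)
  have hb12 : ∀ n, 0 ≤ b12 n := fun n => div_nonneg hβ12 (Hsum_nonneg n)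
  have hb21 : ∀ n, 0 ≤ b21 n := fun n => div_nonneg hβ21 (Hsum_nonneg n)
  have hnull : nullNR h2 h1 = nullNR h1 h2 := by
    ext j
    simp [nullNR, or_comm]
  have hite : ∀ (c : Prop) [Decidable c] (R : Finset (Fin m)),
      FDP (nullNR h1 h2) (if c then ∅ else R) ≤ FDP (nullNR h1 h2) R := by
    intro c _ R
    split_ifs
    · rw [FDP_empty]
      exact FDP_nonneg _ _
    · exact le_rfl
  have hi12 := integrable_fdpMajorant h1 h2 hP1 hP2 hIndep hS12 a12 b12
  have hi21 := integrable_fdpMajorant h2 h1 hP2 hP1 hIndep.symm hS21 a21 b21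
  calc _ ≤ ∫ ω, (fdpMajorant h1 h2 S12 a12 b12 (P1 ω) (P2 ω) +
          fdpMajorant h2 h1 S21 a21 b21 (P2 ω) (P1 ω)) ∂μ := by
        refine integral_mono_of_nonneg (ae_of_all _ fun ω => FDP_nonneg _ _) (hi12.add hi21)
          (ae_of_all _ fun ω => ?_)
        refine (FDP_union_le _ _ _).trans (add_le_add ?_ ?_)
        · exact (hite _ _).trans (FDP_rejSet_le h1 h2 S12 ha12 hb12 _ _)
        · refine (hite _ _).trans ?_
          rw [← hnull]
          exact FDP_rejSet_le h2 h1 S21 ha21 hb21 _ _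
    _ ≤ (w1 * q1 + (w1 * q - w1 * q1)) +
          ((1 - w1) * q1 + ((1 - w1) * q - (1 - w1) * q1)) := by
        rw [integral_add hi12 hi21]
        exact add_le_add
          (integral_fdpMajorant_le h1 h2 hP1 hP2 hsup1 hsup2 hIndep hS12 (by positivity) hβ12)
          (integral_fdpMajorant_le h2 h1 hP2 hP1 hsup2 hsup1 hIndep.symm hS21 (by positivity) hβ21)
    _ = q := by ring

end Replicability
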